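/- Let P_n denote the Pell numbers (P_0 = 0, P_1 = 1, P_n = 2P_{n-1} + P_{n-2}) and Q_n the Pell–Lucas numbers (Q_0 = 2, Q_1 = 2, Q_n = 2Q_{n-1} + Q_{n-2}). Then for every odd positive integer k, ∑_{n=1}^{∞} L( Q_k² / (8·P_{2kn}²) ) + ∑_{n=1}^{∞} L( Q_k² / Q_{k(2n+1)}² ) = L( 1/(1+√2)^{2k} ). -/

import Mathlib

/-- The Rogers dilogarithm on `[0,1]`: `L(x) = Li₂(x) + (1/2)·log x · log (1-x)`
for `0 < x < 1`, with `L 0 = 0` and `L 1 = π²/6`. -/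
noncomputable def rogersL (x : ℝ) : ℝ :=
  if x = 0 then 0
  else if x = 1 then Real.pi ^ 2 / 6
  else (∑' n : ℕ, x ^ (n + 1) / ((n : ℝ) + 1) ^ 2) + 1 / 2 * Real.log x * Real.log (1 - x)

/-- The Pell numbers: `P 0 = 0`, `P 1 = 1`, `P (n+2) = 2·P (n+1) + P n`. -/
def pellNum : ℕ → ℕ
  | 0 => 0
  | 1 => 1
  | n + 2 => 2 * pellNum (n + 1) + pellNum n

/-- The Pell–Lucas numbers: `Q 0 = 2`, `Q 1 = 2`, `Q (n+2) = 2·Q (n+1) + Q n`. -/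
def pellLucasNum : ℕ → ℕ
  | 0 => 2
  | 1 => 2
  | n + 2 => 2 * pellLucasNum (n + 1) + pellLucasNum n

open Set Filter Topology

theorem rogersL_eq (x : ℝ) :
    rogersL x = (∑' n : ℕ, x ^ (n + 1) / ((n : ℝ) + 1) ^ 2) +
      1 / 2 * (Real.log x * Real.log (1 - x)) := by
  unfold rogersL
  split_ifs with h0 h1
  · simp [h0]
  · subst h1
    have h := ((hasSum_nat_add_iff' 1).2 hasSum_zeta_two).tsum_eq
    simp only [Finset.sum_range_one, Nat.cast_zero, Nat.cast_add, Nat.cast_one] at h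
    simp only [one_pow, sub_self, Real.log_zero, mul_zero, add_zero, h]
    simp
  · ring

theorem continuousOn_tsum_pow_div_sq :
    ContinuousOn (fun x : ℝ => ∑' n : ℕ, x ^ (n + 1) / ((n : ℝ) + 1) ^ 2) (Icc 0 1) := by
  have hs : Summable fun n : ℕ => 1 / ((n : ℝ) + 1) ^ 2 := by
    have := (summable_nat_add_iff 1).2 (Real.summable_one_div_nat_pow.2 one_lt_two)
    simpa using this
  refine continuousOn_tsum (fun n => by fun_prop) hs fun n x hx => ?_
  rw [Real.norm_of_nonneg (div_nonneg (pow_nonneg hx.1 _) (sq_nonneg _))]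
  gcongr
  exact pow_le_one₀ hx.1 hx.2

theorem continuousAt_log_mul_log_one_sub_zero :
    ContinuousAt (fun x : ℝ => Real.log x * Real.log (1 - x)) 0 := by
  have hd : DifferentiableAt ℝ (fun x : ℝ => Real.log (1 - x)) 0 :=
    (by fun_prop : DifferentiableAt ℝ (fun x : ℝ => 1 - x) 0).log (by norm_num)
  have hc := (Real.continuous_mul_log.continuousAt (x := (0 : ℝ))).mul
    (continuousAt_dslope_same.2 hd)
  refine hc.congr (Eventually.of_forall fun x => ?_)
  have h := sub_smul_dslope (fun x : ℝ => Real.log (1 - x)) 0 x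
  simp only [sub_zero, smul_eq_mul, Real.log_one] at h
  simp only [Pi.mul_apply, ← h]
  ring

theorem continuous_log_mul_log_one_sub :
    Continuous (fun x : ℝ => Real.log x * Real.log (1 - x)) := by
  refine continuous_iff_continuousAt.2 fun x => ?_
  rcases eq_or_ne x 0 with rfl | h0
  · exact continuousAt_log_mul_log_one_sub_zero
  rcases eq_or_ne x 1 with rfl | h1
  · have h : ContinuousAt (fun x : ℝ => 1 - x) 1 := by fun_prop
    have hz := continuousAt_log_mul_log_one_sub_zero
    refine (hz.comp_of_eq h (sub_self 1)).congr (Eventually.of_forall fun x => ?_)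
    simp [mul_comm]
  · exact (continuousAt_id.log h0).mul
      ((by fun_prop : ContinuousAt (fun x : ℝ => 1 - x) x).log (sub_ne_zero.2 h1.symm))

theorem continuousOn_rogersL : ContinuousOn rogersL (Icc 0 1) := by
  rw [funext rogersL_eq]
  exact continuousOn_tsum_pow_div_sq.add
    (continuous_const.mul continuous_log_mul_log_one_sub).continuousOn

theorem hasDerivAt_tsum_pow_div_sq {x : ℝ} (hx : x ∈ Ioo 0 1) :
    HasDerivAt (fun x : ℝ => ∑' n : ℕ, x ^ (n + 1) / ((n : ℝ) + 1) ^ 2)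
      (-Real.log (1 - x) / x) x := by
  obtain ⟨r, hxr, hr⟩ := exists_between hx.2
  have hr0 : 0 < r := hx.1.trans hxr
  have hxa : |x| < 1 := by rw [abs_of_pos hx.1]; exact hx.2
  have key := hasDerivAt_tsum_of_isPreconnected (𝕜 := ℝ)
    (g := fun (n : ℕ) (y : ℝ) => y ^ (n + 1) / ((n : ℝ) + 1) ^ 2)
    (g' := fun (n : ℕ) (y : ℝ) => y ^ n / ((n : ℝ) + 1)) (y₀ := x) (y := x) (t := Ioo 0 r)
    (summable_geometric_of_lt_one hr0.le hr) isOpen_Ioo isPreconnected_Ioo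
    (fun n y _ => by
      have h := (hasDerivAt_pow (n + 1) y).div_const (((n : ℝ) + 1) ^ 2)
      refine h.congr_deriv ?_
      have : (n : ℝ) + 1 ≠ 0 := by positivity
      simp only [Nat.add_sub_cancel, Nat.cast_add, Nat.cast_one]
      field_simp)
    (fun n y hy => by
      rw [Real.norm_of_nonneg (div_nonneg (pow_nonneg hy.1.le _) (by positivity))]
      have hn : (1 : ℝ) ≤ n + 1 := by simp
      calc y ^ n / ((n : ℝ) + 1) ≤ y ^ n := div_le_self (pow_nonneg hy.1.le _) hn
        _ ≤ r ^ n := pow_le_pow_left₀ hy.1.le hy.2.le n)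
    ⟨hx.1, hxr⟩
    (by
      refine Summable.of_nonneg_of_le
        (fun n => div_nonneg (pow_nonneg hx.1.le _) (by positivity)) (fun n => ?_)
        (Real.hasSum_pow_div_log_of_abs_lt_one hxa).summable
      have hn : (1 : ℝ) ≤ n + 1 := by simp
      have := hx.1
      gcongr
      exact le_self_pow₀ hn two_ne_zero)
    ⟨hx.1, hxr⟩
  have h := (Real.hasSum_pow_div_log_of_abs_lt_one hxa).div_const x
  rw [← h.tsum_eq]
  refine key.congr_deriv (tsum_congr fun n => ?_)
  have := hx.1.ne'
  field_simp
  ring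

theorem hasDerivAt_rogersL {x : ℝ} (hx : x ∈ Ioo 0 1) :
    HasDerivAt rogersL (-(1 / 2) * (Real.log (1 - x) / x + Real.log x / (1 - x))) x := by
  rw [funext rogersL_eq]
  have h0 : x ≠ 0 := hx.1.ne'
  have h1 : 1 - x ≠ 0 := (sub_pos.2 hx.2).ne'
  have h := (hasDerivAt_tsum_pow_div_sq hx).add
    (((Real.hasDerivAt_log h0).mul (((hasDerivAt_id x).const_sub 1).log h1)).const_mul (1 / 2))
  refine h.congr_deriv ?_
  simp only [id]
  field_simp
  ring

theorem rogersL_zero : rogersL 0 = 0 := by simp [rogersL]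

theorem rogersL_one : rogersL 1 = Real.pi ^ 2 / 6 := by simp [rogersL]

theorem rogersL_nonneg {x : ℝ} (hx : x ∈ Icc 0 1) : 0 ≤ rogersL x := by
  rw [rogersL_eq]
  have h : 0 ≤ Real.log x * Real.log (1 - x) :=
    mul_nonneg_of_nonpos_of_nonpos (Real.log_nonpos hx.1 hx.2)
      (Real.log_nonpos (sub_nonneg.2 hx.2) (by linarith [hx.1]))
  have h' : 0 ≤ ∑' n : ℕ, x ^ (n + 1) / ((n : ℝ) + 1) ^ 2 :=
    tsum_nonneg fun n => div_nonneg (pow_nonneg hx.1 _) (sq_nonneg _)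
  positivity

theorem eq_of_hasDerivAt_zero {F : ℝ → ℝ} {a b : ℝ} (hab : a < b)
    (hc : ContinuousOn F (Icc a b)) (hd : ∀ x ∈ Ioo a b, HasDerivAt F 0 x) : F b = F a := by
  obtain ⟨c, -, h⟩ := exists_hasDerivAt_eq_slope F (fun _ => 0) hab hc hd
  have : b - a ≠ 0 := (sub_pos.2 hab).ne'
  field_simp at h
  linarith

/-- Euler's reflection formula. -/
theorem rogersL_add_rogersL_one_sub {x : ℝ} (hx : x ∈ Ioo 0 1) :
    rogersL x + rogersL (1 - x) = Real.pi ^ 2 / 6 := by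
  have h := eq_of_hasDerivAt_zero (F := fun x => rogersL x + rogersL (1 - x)) hx.1
    (by
      refine (continuousOn_rogersL.mono (Icc_subset_Icc_right hx.2.le)).add
        (continuousOn_rogersL.comp (by fun_prop) fun t ht => ?_)
      exact ⟨by linarith [ht.2, hx.2], by linarith [ht.1]⟩)
    (fun t ht => by
      have ht1 : t < 1 := ht.2.trans hx.2
      have h1 := hasDerivAt_rogersL ⟨ht.1, ht1⟩
      have h2 := (hasDerivAt_rogersL (x := 1 - t) ⟨by linarith, by linarith [ht.1]⟩).comp t
        ((hasDerivAt_id t).const_sub 1)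
      refine (h1.add h2).congr_deriv ?_
      simp only [sub_sub_cancel]
      ring)
  simpa [rogersL_zero, rogersL_one] using h

/-- Abel's five-term relation. -/
theorem rogersL_five_term {x y : ℝ} (hx : x ∈ Ioo 0 1) (hy : y ∈ Ioo 0 1) :
    rogersL x + rogersL y = rogersL (x * y) + rogersL (x * (1 - y) / (1 - x * y)) +
      rogersL (y * (1 - x) / (1 - x * y)) := by
  obtain ⟨hy0, hy1⟩ := hy
  have hxy : ∀ t ∈ Icc 0 x, 0 < 1 - t * y := fun t ht => by
    nlinarith [ht.1, ht.2, hx.2]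
  have h := eq_of_hasDerivAt_zero (F := fun t => rogersL t - rogersL (t * y) -
      rogersL (t * (1 - y) / (1 - t * y)) - rogersL (y * (1 - t) / (1 - t * y))) hx.1
    (by
      refine (((continuousOn_rogersL.mono (Icc_subset_Icc_right hx.2.le)).sub
        (continuousOn_rogersL.comp (by fun_prop) fun t ht => ?_)).sub
        (continuousOn_rogersL.comp (ContinuousOn.div (by fun_prop) (by fun_prop)
          fun t ht => (hxy t ht).ne') fun t ht => ?_)).sub
        (continuousOn_rogersL.comp (ContinuousOn.div (by fun_prop) (by fun_prop)
          fun t ht => (hxy t ht).ne') fun t ht => ?_)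
      all_goals have ht1 : t < 1 := ht.2.trans_lt hx.2
      all_goals have hp := hxy t ht
      all_goals have ht0 := ht.1
      · exact ⟨by positivity, by linarith⟩
      · refine ⟨div_nonneg (mul_nonneg ht0 (by linarith)) hp.le, ?_⟩
        exact (div_le_one hp).2 (by linarith)
      · refine ⟨div_nonneg (mul_nonneg hy0.le (by linarith)) hp.le, ?_⟩
        exact (div_le_one hp).2 (by linarith))
    (fun t ht => by
      have ht0 : 0 < t := ht.1
      have ht1 : 0 < 1 - t := by linarith [ht.2, hx.2]
      have hz1 : 0 < 1 - y := by linarith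
      have hp := hxy t ⟨ht.1.le, ht.2.le⟩
      have e1 : 1 - t * (1 - y) / (1 - t * y) = (1 - t) / (1 - t * y) := by
        rw [eq_div_iff hp.ne', sub_mul, div_mul_cancel₀ _ hp.ne']; ring
      have e2 : 1 - y * (1 - t) / (1 - t * y) = (1 - y) / (1 - t * y) := by
        rw [eq_div_iff hp.ne', sub_mul, div_mul_cancel₀ _ hp.ne']; ring
      have dm : HasDerivAt (fun t => t * y) y t := by
        simpa using (hasDerivAt_id t).mul_const y
      have dp : HasDerivAt (fun t => 1 - t * y) (-y) t := by
        simpa using dm.const_sub 1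
      have dn1 : HasDerivAt (fun t => t * (1 - y)) (1 - y) t := by
        simpa using (hasDerivAt_id t).mul_const (1 - y)
      have dn2 : HasDerivAt (fun t => y * (1 - t)) (-y) t := by
        simpa using ((hasDerivAt_id t).const_sub 1).const_mul y
      have d0 := hasDerivAt_rogersL (x := t) ⟨ht0, by linarith⟩
      have d1 := (hasDerivAt_rogersL (x := t * y) ⟨by positivity, by linarith⟩).comp t dm
      have d2 := (hasDerivAt_rogersL (x := t * (1 - y) / (1 - t * y))
        ⟨by positivity, by rw [div_lt_one hp]; linarith⟩).comp t (dn1.div dp hp.ne')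
      have d3 := (hasDerivAt_rogersL (x := y * (1 - t) / (1 - t * y))
        ⟨by positivity, by rw [div_lt_one hp]; linarith⟩).comp t (dn2.div dp hp.ne')
      refine (((d0.sub d1).sub d2).sub d3).congr_deriv ?_
      rw [e1, e2, Real.log_div ht1.ne' hp.ne', Real.log_div hz1.ne' hp.ne',
        Real.log_div (by positivity) hp.ne', Real.log_div (by positivity) hp.ne',
        Real.log_mul ht0.ne' hz1.ne', Real.log_mul hy0.ne' ht1.ne',
        Real.log_mul ht0.ne' hy0.ne']
      generalize Real.log t = A
      generalize Real.log (1 - t) = B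
      generalize Real.log y = C
      generalize Real.log (1 - y) = D
      generalize Real.log (1 - t * y) = E
      field_simp
      ring)
  simp [rogersL_zero] at h
  linarith

/-- The ratios `(1 - q ^ m) / (1 - q ^ (m + 1))` of consecutive `q`-integers. -/
noncomputable def qRatio (q : ℝ) (m : ℕ) : ℝ := (1 - q ^ m) / (1 - q ^ (m + 1))

theorem qRatio_mem_Ioo {q : ℝ} (hq : q ∈ Ioo 0 1) (m : ℕ) : qRatio q (m + 1) ∈ Ioo 0 1 := by
  have h1 : q ^ (m + 1) < 1 := pow_lt_one₀ hq.1.le hq.2 (by simp)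
  have h2 : q ^ (m + 1 + 1) < q ^ (m + 1) := by
    rw [pow_succ q (m + 1)]
    exact mul_lt_of_lt_one_right (pow_pos hq.1 _) hq.2
  unfold qRatio
  exact ⟨div_pos (by linarith) (by linarith), by rw [div_lt_one (by linarith)]; linarith⟩

theorem one_sub_qRatio_div {q : ℝ} (hq : q ∈ Ioo 0 1) (m : ℕ) :
    1 - qRatio q (m + 1) / qRatio q (m + 2) =
      q ^ (m + 1) * (1 - q) ^ 2 / (1 - q ^ (m + 2)) ^ 2 := by
  have h : ∀ j, 1 - q ^ (j + 1) ≠ 0 := fun j =>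
    (sub_pos.2 (pow_lt_one₀ hq.1.le hq.2 (by simp))).ne'
  have h1 := h m
  have h2 := h (m + 1)
  have h3 := h (m + 2)
  unfold qRatio
  simp only [add_assoc, Nat.reduceAdd] at *
  field_simp
  ring

theorem rogersL_telescope {q : ℝ} (hq : q ∈ Ioo 0 1) (m : ℕ) :
    rogersL (q ^ (m + 1) * (1 - q) ^ 2 / (1 - q ^ (m + 2)) ^ 2) =
      (rogersL (qRatio q (m + 2)) + rogersL (q * qRatio q (m + 2))) -
      (rogersL (qRatio q (m + 1)) + rogersL (q * qRatio q (m + 1))) := by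
  have hu := qRatio_mem_Ioo hq m
  have hv := qRatio_mem_Ioo hq (m + 1)
  have hw := one_sub_qRatio_div hq m
  have hwpos : 0 < q ^ (m + 1) * (1 - q) ^ 2 / (1 - q ^ (m + 2)) ^ 2 := by
    have h2 : 0 < 1 - q ^ (m + 2) := sub_pos.2 (pow_lt_one₀ hq.1.le hq.2 (by simp))
    have h3 : 0 < 1 - q := sub_pos.2 hq.2
    have h4 := hq.1
    positivity
  have hy : qRatio q (m + 1) / qRatio q (m + 2) ∈ Ioo 0 1 :=
    ⟨div_pos hu.1 hv.1, by linarith⟩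
  have hqv : q * qRatio q (m + 2) ∈ Ioo 0 1 :=
    ⟨mul_pos hq.1 hv.1, mul_lt_one_of_nonneg_of_lt_one_left hq.1.le hq.2 hv.2.le⟩
  have r1 := rogersL_add_rogersL_one_sub hy
  have r2 := rogersL_add_rogersL_one_sub hqv
  have five := rogersL_five_term hv hy
  have hne : qRatio q (m + 2) ≠ 0 := hv.1.ne'
  have e0 : qRatio q (m + 2) * (qRatio q (m + 1) / qRatio q (m + 2)) = qRatio q (m + 1) := by
    field_simp
  have hune : 1 - qRatio q (m + 1) ≠ 0 := (sub_pos.2 hu.2).ne'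
  have e2 : qRatio q (m + 1) / qRatio q (m + 2) * (1 - qRatio q (m + 2)) /
      (1 - qRatio q (m + 1)) = q * qRatio q (m + 1) := by
    have h : ∀ j, 1 - q ^ (j + 1) ≠ 0 := fun j =>
      (sub_pos.2 (pow_lt_one₀ hq.1.le hq.2 (by simp))).ne'
    have h1 := h m
    have h2 := h (m + 1)
    have h3 := h (m + 2)
    rw [div_mul_eq_mul_div, div_div, div_eq_iff (mul_ne_zero hne hune)]
    unfold qRatio
    simp only [add_assoc, Nat.reduceAdd] at *
    field_simp
    ring
  have e1 : qRatio q (m + 2) * (1 - qRatio q (m + 1) / qRatio q (m + 2)) /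
      (1 - qRatio q (m + 1)) = 1 - q * qRatio q (m + 2) := by
    have : 1 - q * qRatio q (m + 2) =
        1 - qRatio q (m + 2) * (q * qRatio q (m + 1)) / qRatio q (m + 1) := by
      have := hu.1.ne'
      field_simp
    rw [this, ← e2]
    have := hu.1.ne'
    field_simp
    ring
  rw [e0, e1, e2] at five
  rw [← hw]
  linarith

theorem hasSum_rogersL {q : ℝ} (hq : q ∈ Ioo 0 1) :
    HasSum (fun m : ℕ => rogersL (q ^ (m + 1) * (1 - q) ^ 2 / (1 - q ^ (m + 2)) ^ 2))
      (rogersL q) := by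
  have hqq : ∀ m, q * qRatio q (m + 1) ∈ Ioo 0 1 := fun m =>
    ⟨mul_pos hq.1 (qRatio_mem_Ioo hq m).1,
      mul_lt_one_of_nonneg_of_lt_one_left hq.1.le hq.2 (qRatio_mem_Ioo hq m).2.le⟩
  rw [hasSum_iff_tendsto_nat_of_nonneg]
  · simp_rw [rogersL_telescope hq]
    have hsum : ∀ n, ∑ m ∈ Finset.range n,
        ((rogersL (qRatio q (m + 2)) + rogersL (q * qRatio q (m + 2))) -
        (rogersL (qRatio q (m + 1)) + rogersL (q * qRatio q (m + 1)))) =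
        (rogersL (qRatio q (n + 1)) + rogersL (q * qRatio q (n + 1))) - rogersL 1 := by
      intro n
      rw [Finset.sum_range_sub (fun m => rogersL (qRatio q (m + 1)) +
        rogersL (q * qRatio q (m + 1)))]
      have h := rogersL_add_rogersL_one_sub (qRatio_mem_Ioo hq 0)
      have e : 1 - qRatio q (0 + 1) = q * qRatio q (0 + 1) := by
        have h1 : 1 - q ^ 2 ≠ 0 :=
          (sub_pos.2 (pow_lt_one₀ hq.1.le hq.2 (by simp))).ne'
        unfold qRatio
        simp only [zero_add, Nat.reduceAdd, pow_one]
        field_simp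
        ring
      rw [e] at h
      rw [h, rogersL_one]
    simp_rw [hsum]
    have hp : Tendsto (fun n : ℕ => q ^ n) atTop (𝓝 0) :=
      tendsto_pow_atTop_nhds_zero_of_lt_one hq.1.le hq.2
    have hr : Tendsto (fun n => qRatio q (n + 1)) atTop (𝓝 1) := by
      have h := ((hp.comp (tendsto_add_atTop_nat 1)).const_sub 1).div
        ((hp.comp (tendsto_add_atTop_nat 2)).const_sub 1) (by simp)
      simpa [qRatio, Function.comp_def, Pi.div_def] using h
    have h1 : Tendsto (fun n => rogersL (qRatio q (n + 1))) atTop (𝓝 (rogersL 1)) :=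
      (continuousOn_rogersL 1 (by simp)).tendsto.comp
        (tendsto_nhdsWithin_iff.2 ⟨hr, Eventually.of_forall fun n =>
          Ioo_subset_Icc_self (qRatio_mem_Ioo hq n)⟩)
    have h2 : Tendsto (fun n => rogersL (q * qRatio q (n + 1))) atTop (𝓝 (rogersL q)) :=
      (continuousOn_rogersL q (Ioo_subset_Icc_self hq)).tendsto.comp
        (tendsto_nhdsWithin_iff.2 ⟨by simpa using hr.const_mul q,
          Eventually.of_forall fun n => Ioo_subset_Icc_self (hqq n)⟩)
    simpa using (h1.add h2).sub_const (rogersL 1)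
  · intro m
    rw [← one_sub_qRatio_div hq m]
    have hu := qRatio_mem_Ioo hq m
    have hv := qRatio_mem_Ioo hq (m + 1)
    have hw := one_sub_qRatio_div hq m
    have : 0 ≤ q ^ (m + 1) * (1 - q) ^ 2 / (1 - q ^ (m + 2)) ^ 2 := by
      have h4 := hq.1
      positivity
    exact rogersL_nonneg ⟨by linarith, by linarith [div_pos hu.1 hv.1]⟩

theorem pellNum_eq (n : ℕ) :
    2 * √2 * (pellNum n : ℝ) = (1 + √2) ^ n - (1 - √2) ^ n := by
  have h2 : √2 ^ 2 = (2 : ℝ) := Real.sq_sqrt (by norm_num)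
  induction n using pellNum.induct with
  | case1 => simp [pellNum]
  | case2 => simp [pellNum]; ring
  | case3 n ih1 ih2 =>
    rw [pellNum]
    push_cast [Nat.succ_eq_add_one]
    linear_combination 2 * ih1 + ih2 - ((1 + √2) ^ n - (1 - √2) ^ n) * h2

theorem pellLucasNum_eq (n : ℕ) :
    (pellLucasNum n : ℝ) = (1 + √2) ^ n + (1 - √2) ^ n := by
  have h2 : √2 ^ 2 = (2 : ℝ) := Real.sq_sqrt (by norm_num)
  induction n using pellLucasNum.induct with
  | case1 => norm_num [pellLucasNum]
  | case2 => simp [pellLucasNum]; ring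
  | case3 n ih1 ih2 =>
    rw [pellLucasNum]
    push_cast [Nat.succ_eq_add_one]
    linear_combination 2 * ih1 + ih2 - ((1 + √2) ^ n + (1 - √2) ^ n) * h2

theorem sq_div_sq_eq_of_mul_eq_one {a b : ℝ} (hab : a * b = 1) (m : ℕ) :
    (a - b) ^ 2 / (a ^ (m + 2) - b ^ (m + 2)) ^ 2 =
      (b ^ 2) ^ (m + 1) * (1 - b ^ 2) ^ 2 / (1 - (b ^ 2) ^ (m + 2)) ^ 2 := by
  have hb : b ≠ 0 := right_ne_zero_of_mul_eq_one hab
  obtain rfl : a = b⁻¹ := eq_inv_of_mul_eq_one_left hab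
  have e1 : b⁻¹ - b = b⁻¹ * (1 - b ^ 2) := by field_simp
  have e2 : b⁻¹ ^ (m + 2) - b ^ (m + 2) = b⁻¹ ^ (m + 2) * (1 - (b ^ 2) ^ (m + 2)) := by
    rw [mul_sub, mul_one, ← mul_pow]
    congr 2
    field_simp
  have e3 : (b ^ 2) ^ (m + 1) = b⁻¹ ^ 2 / (b⁻¹ ^ (m + 2)) ^ 2 := by
    simp only [inv_pow]
    field_simp
    ring
  rw [e1, e2, e3, mul_pow, mul_pow, mul_div_mul_comm, mul_div_assoc]

theorem tsum_even_add_tsum_odd_of_hasSum {f : ℕ → ℝ} {a : ℝ} (h : HasSum f a) :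
    ∑' n, f (2 * n) + ∑' n, f (2 * n + 1) = a := by
  have he : Summable fun n => f (2 * n) :=
    h.summable.comp_injective (i := fun n => 2 * n) fun _ _ h => by simpa using h
  have ho : Summable fun n => f (2 * n + 1) :=
    h.summable.comp_injective (i := fun n => 2 * n + 1) fun _ _ h => by simpa using h
  rw [tsum_even_add_odd he ho, h.tsum_eq]

theorem stmt_18 (k : ℕ) (hk : 0 < k) (hkodd : Odd k) :
    (∑' n : ℕ, rogersL ((pellLucasNum k : ℝ) ^ 2 / (8 * (pellNum (2 * k * (n + 1)) : ℝ) ^ 2))) +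
      (∑' n : ℕ, rogersL ((pellLucasNum k : ℝ) ^ 2 /
        (pellLucasNum (k * (2 * (n + 1) + 1)) : ℝ) ^ 2)) =
      rogersL (1 / (1 + Real.sqrt 2) ^ (2 * k)) := by
  have h2 : √2 ^ 2 = (2 : ℝ) := Real.sq_sqrt (by norm_num)
  have hs : 1 < √2 := by
    rw [Real.lt_sqrt] <;> norm_num
  have hs2 : √2 < 2 := by nlinarith
  set a : ℝ := (1 + √2) ^ k with ha
  set b : ℝ := (√2 - 1) ^ k with hb
  have hc : (1 - √2) ^ k = -b := by rw [hb, ← hkodd.neg_pow, neg_sub]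
  have hab : a * b = 1 := by
    rw [ha, hb, ← mul_pow]
    have : (1 + √2) * (√2 - 1) = 1 := by linear_combination h2
    rw [this, one_pow]
  have hb0 : 0 < b := pow_pos (by linarith) k
  have hb1 : b < 1 := pow_lt_one₀ (by linarith) (by linarith) hk.ne'
  have hq : b ^ 2 ∈ Ioo (0 : ℝ) 1 := ⟨by positivity, pow_lt_one₀ hb0.le hb1 two_ne_zero⟩
  have hQk : (pellLucasNum k : ℝ) = a - b := by rw [pellLucasNum_eq, hc, ← ha]; ring
  have hP (n : ℕ) : 8 * (pellNum (2 * k * (n + 1)) : ℝ) ^ 2 =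
      (a ^ (2 * n + 2) - b ^ (2 * n + 2)) ^ 2 := by
    have h := pellNum_eq (2 * k * (n + 1))
    rw [show 2 * k * (n + 1) = k * (2 * n + 2) by ring, pow_mul, pow_mul, hc, ← ha,
      Even.neg_pow ⟨n + 1, by ring⟩] at h
    rw [show 2 * k * (n + 1) = k * (2 * n + 2) by ring, ← h]
    linear_combination (-4 * (pellNum (k * (2 * n + 2)) : ℝ) ^ 2) * h2
  have hQ (n : ℕ) : (pellLucasNum (k * (2 * (n + 1) + 1)) : ℝ) =
      a ^ (2 * n + 1 + 2) - b ^ (2 * n + 1 + 2) := by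
    rw [pellLucasNum_eq, pow_mul, pow_mul, hc, ← ha, Odd.neg_pow ⟨n + 1, rfl⟩]
    ring
  have hq' : 1 / (1 + √2) ^ (2 * k) = b ^ 2 := by
    rw [mul_comm 2 k, pow_mul, ← ha, div_eq_iff (pow_ne_zero _ (left_ne_zero_of_mul_eq_one hab)),
      ← mul_pow, mul_comm, hab, one_pow]
  have hsum := hasSum_rogersL hq
  simp_rw [← sq_div_sq_eq_of_mul_eq_one hab] at hsum
  simp_rw [hQk, hP, hQ, hq']
  exact tsum_even_add_tsum_odd_of_hasSum hsum
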